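/- arXiv:math/0404044 — 3 statements merged into one kernel-verified Lean document; each statement's English description precedes it below -/
import Mathlib

section
/- Let T be a finite rooted tree of height n with generation cardinalities |Tᵢ| = bᵢ for i = 1,...,n, label its vertices by i.i.d. random variables with law μ, and let φ(T; D) be the probability that every root-to-leaf path (X(w₁),...,X(wₙ)) lies in the Borel set D ⊆ ℝⁿ. Then φ(T; D) ≥ Ψ(b₁,...,bₙ; D), where Ψ is the corresponding quantity for the spherically symmetric tree with the same generation sizes (extended to real arguments via the recursion). -/
open MeasureTheory ProbabilityTheory Filter Finset

/-- The recursively defined path-probability function `Ψ` for spherically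
symmetric trees, extended to positive real generation sizes:
`Ψ(b; D) = μ(D)^b` and
`Ψ(b₁,…,bₙ; D) = (∫ Ψ(b₂/b₁,…,bₙ/b₁; D/x₁) dμ(x₁))^{b₁}`. -/
noncomputable def Psi (μ : Measure ℝ) : (n : ℕ) → (Fin (n + 1) → ℝ) → Set (Fin (n + 1) → ℝ) → ℝ
  | 0, b, D => (μ {x | (fun _ : Fin 1 => x) ∈ D}).toReal ^ (b 0)
  | n + 1, b, D =>
      (∫ x, Psi μ n (fun i => b i.succ / b 0) {y | Fin.cons x y ∈ D} ∂μ) ^ (b 0)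

/-- The nonroot vertices of the height-`n` tree whose set of depth-`n` vertices
(leaves, identified with their address lists) is `A`: all nonempty prefixes of leaves. -/
def verts (n : ℕ) (A : Finset (List ℕ)) : Finset (List ℕ) :=
  A.biUnion fun a => (Finset.range n).image fun i => a.take (i + 1)

lemma take_mem_verts {n : ℕ} {A : Finset (List ℕ)} {a : List ℕ} (ha : a ∈ A)
    {i : ℕ} (hi : i < n) : a.take (i + 1) ∈ verts n A :=
  Finset.mem_biUnion.2 ⟨a, ha, Finset.mem_image.2 ⟨i, Finset.mem_range.2 hi, rfl⟩⟩

/-- `P(B; Γ)`: with i.i.d. labels of law `μ` on the vertices, the probability that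
some root-to-leaf path of the tree with leaf set `A` has label sequence in `B`. -/
noncomputable def pathProb (μ : Measure ℝ) (n : ℕ) (A : Finset (List ℕ))
    (B : Set (Fin n → ℝ)) : ℝ :=
  ((Measure.pi fun _ : ↥(verts n A) => μ)
    {ω | ∃ a, ∃ ha : a ∈ A,
      (fun i : Fin n => ω ⟨a.take (i.val + 1), take_mem_verts ha i.isLt⟩) ∈ B}).toReal

/-- `φ(T; D)`: the probability that every root-to-leaf path has label sequence in `D`. -/
noncomputable def allPathProb (μ : Measure ℝ) (n : ℕ) (A : Finset (List ℕ))
    (D : Set (Fin n → ℝ)) : ℝ :=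
  ((Measure.pi fun _ : ↥(verts n A) => μ)
    {ω | ∀ a, ∀ ha : a ∈ A,
      (fun i : Fin n => ω ⟨a.take (i.val + 1), take_mem_verts ha i.isLt⟩) ∈ D}).toReal

/-- the cardinality `|T_i|` of generation `i` of the tree with leaf set `A`. -/
def levelCard (A : Finset (List ℕ)) (i : ℕ) : ℕ := (A.image fun a => a.take i).card

lemma measurable_fin_cons (n : ℕ) :
    Measurable fun p : ℝ × (Fin n → ℝ) => (Fin.cons p.1 p.2 : Fin (n + 1) → ℝ) := by
  refine measurable_pi_iff.2 fun i => ?_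
  refine Fin.cases ?_ (fun j => ?_) i
  · simpa using measurable_fst
  · simpa using (by fun_prop : Measurable fun p : ℝ × (Fin n → ℝ) => p.2 j)

lemma measurableSet_cons_section {n : ℕ} {D : Set (Fin (n + 1) → ℝ)} (hD : MeasurableSet D)
    (x : ℝ) : MeasurableSet {y : Fin n → ℝ | (Fin.cons x y : Fin (n + 1) → ℝ) ∈ D} :=
  ((measurable_fin_cons n).comp (measurable_prodMk_left (x := x))) hD

lemma Psi_nonneg (μ : Measure ℝ) (n : ℕ) (b : Fin (n + 1) → ℝ) (D : Set (Fin (n + 1) → ℝ)) :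
    0 ≤ Psi μ n b D := by
  induction n with
  | zero => exact Real.rpow_nonneg ENNReal.toReal_nonneg _
  | succ n ih => exact Real.rpow_nonneg (integral_nonneg fun x => ih _ _) _

lemma measurable_Psi_section (μ : Measure ℝ) [SFinite μ] (n : ℕ) {Z : Type} [MeasurableSpace Z]
    (b : Fin (n + 1) → ℝ) {D : Set (Z × (Fin (n + 1) → ℝ))} (hD : MeasurableSet D) :
    Measurable fun z => Psi μ n b {y | (z, y) ∈ D} := by
  induction n generalizing Z with
  | zero =>
    have hm : Measurable fun p : Z × ℝ => (p.1, fun _ : Fin 1 => p.2) := by fun_prop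
    exact ((measurable_measure_prodMk_left (ν := μ) (hm hD)).ennreal_toReal).pow_const _
  | succ n ih =>
    have hm : Measurable fun p : (Z × ℝ) × (Fin (n + 1) → ℝ) =>
        (p.1.1, (Fin.cons p.1.2 p.2 : Fin (n + 2) → ℝ)) :=
      (by fun_prop : Measurable fun p : (Z × ℝ) × (Fin (n + 1) → ℝ) => p.1.1).prodMk
        ((measurable_fin_cons _).comp
          (by fun_prop : Measurable fun p : (Z × ℝ) × (Fin (n + 1) → ℝ) => (p.1.2, p.2)))
    have h := ih (fun i => b i.succ / b 0) (hm hD)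
    exact (h.stronglyMeasurable.integral_prod_right (ν := μ)).measurable.pow_const _

lemma measurable_Psi_cons (μ : Measure ℝ) [SFinite μ] (n : ℕ) (b : Fin (n + 1) → ℝ)
    {D : Set (Fin (n + 2) → ℝ)} (hD : MeasurableSet D) :
    Measurable fun x : ℝ => Psi μ n b {y | (Fin.cons x y : Fin (n + 2) → ℝ) ∈ D} :=
  measurable_Psi_section μ n b ((measurable_fin_cons (n + 1)) hD)

lemma Psi_le_one (μ : Measure ℝ) [IsProbabilityMeasure μ] (n : ℕ) (b : Fin (n + 1) → ℝ)
    (hb : ∀ i, 0 ≤ b i) {D : Set (Fin (n + 1) → ℝ)} (hD : MeasurableSet D) :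
    Psi μ n b D ≤ 1 := by
  induction n with
  | zero => exact Real.rpow_le_one ENNReal.toReal_nonneg measureReal_le_one (hb 0)
  | succ n ih =>
    refine Real.rpow_le_one (integral_nonneg fun x => Psi_nonneg _ _ _ _) ?_ (hb 0)
    have h : ∀ x, Psi μ n (fun i => b i.succ / b 0) {y | Fin.cons x y ∈ D} ≤ 1 := fun x =>
      ih _ (fun i => div_nonneg (hb _) (hb _)) (measurableSet_cons_section hD x)
    calc _ ≤ ∫ _, (1 : ℝ) ∂μ :=
          integral_mono_of_nonneg (ae_of_all _ fun x => Psi_nonneg _ _ _ _)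
            (integrable_const _) (ae_of_all _ h)
      _ = 1 := by simp

lemma integrable_Psi_cons (μ : Measure ℝ) [IsProbabilityMeasure μ] (n : ℕ)
    (b : Fin (n + 1) → ℝ) (hb : ∀ i, 0 ≤ b i)
    {D : Set (Fin (n + 2) → ℝ)} (hD : MeasurableSet D) :
    Integrable (fun x : ℝ => Psi μ n b {y | (Fin.cons x y : Fin (n + 2) → ℝ) ∈ D}) μ := by
  refine Integrable.of_bound (measurable_Psi_cons μ n b hD).aestronglyMeasurable 1
    (ae_of_all _ fun x => ?_)
  rw [Real.norm_of_nonneg (Psi_nonneg _ _ _ _)]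
  exact Psi_le_one μ n b hb (measurableSet_cons_section hD x)

lemma Psi_smul (μ : Measure ℝ) (n : ℕ) (b : Fin (n + 1) → ℝ) {c : ℝ} (hc : c ≠ 0)
    (D : Set (Fin (n + 1) → ℝ)) :
    Psi μ n (fun i => c * b i) D = Psi μ n b D ^ c := by
  cases n with
  | zero =>
    simp only [Psi]
    rw [← Real.rpow_mul ENNReal.toReal_nonneg, mul_comm]
  | succ n =>
    simp only [Psi, mul_div_mul_left _ _ hc]
    rw [← Real.rpow_mul (integral_nonneg fun x => Psi_nonneg _ _ _ _), mul_comm]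

/-- Hölder's inequality in its geometric form, for real-valued functions. -/
lemma integral_rpow_mul_rpow_le {α : Type*} [MeasurableSpace α] {ν : Measure α} {f g : α → ℝ}
    (hf : Integrable f ν) (hg : Integrable g ν) (hf0 : ∀ x, 0 ≤ f x) (hg0 : ∀ x, 0 ≤ g x)
    {p q : ℝ} (hp : 0 ≤ p) (hq : 0 ≤ q) (hpq : p + q = 1) :
    Integrable (fun x => f x ^ p * g x ^ q) ν ∧
      ∫ x, f x ^ p * g x ^ q ∂ν ≤ (∫ x, f x ∂ν) ^ p * (∫ x, g x ∂ν) ^ q := by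
  have hm : AEStronglyMeasurable (fun x => f x ^ p * g x ^ q) ν :=
    ((hf.aemeasurable.pow_const p).mul (hg.aemeasurable.pow_const q)).aestronglyMeasurable
  have h0 : ∀ x, 0 ≤ f x ^ p * g x ^ q := fun x =>
    mul_nonneg (Real.rpow_nonneg (hf0 x) _) (Real.rpow_nonneg (hg0 x) _)
  have hint : Integrable (fun x => f x ^ p * g x ^ q) ν := by
    refine Integrable.mono' ((hf.const_mul p).add (hg.const_mul q)) hm (ae_of_all _ fun x => ?_)
    rw [Real.norm_of_nonneg (h0 x)]
    exact Real.geom_mean_le_arith_mean2_weighted hp hq (hf0 x) (hg0 x) hpq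
  refine ⟨hint, ?_⟩
  have hF := integral_nonneg (μ := ν) (f := f) fun x => hf0 x
  have hG := integral_nonneg (μ := ν) (f := g) fun x => hg0 x
  rw [← ENNReal.ofReal_le_ofReal_iff
      (mul_nonneg (Real.rpow_nonneg hF _) (Real.rpow_nonneg hG _)),
    ENNReal.ofReal_mul (Real.rpow_nonneg hF _), ← ENNReal.ofReal_rpow_of_nonneg hF hp,
    ← ENNReal.ofReal_rpow_of_nonneg hG hq,
    ofReal_integral_eq_lintegral_ofReal hint (ae_of_all _ h0),
    ofReal_integral_eq_lintegral_ofReal hf (ae_of_all _ hf0),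
    ofReal_integral_eq_lintegral_ofReal hg (ae_of_all _ hg0)]
  convert ENNReal.lintegral_mul_norm_pow_le hf.aemeasurable.ennreal_ofReal
    hg.aemeasurable.ennreal_ofReal hp hq hpq using 3 with x
  rw [ENNReal.ofReal_mul (Real.rpow_nonneg (hf0 x) _), ENNReal.ofReal_rpow_of_nonneg (hf0 x) hp,
    ENNReal.ofReal_rpow_of_nonneg (hg0 x) hq]

/-- `log Ψ` is subadditive in the generation sizes. -/
lemma Psi_add_le_mul (μ : Measure ℝ) [IsProbabilityMeasure μ] (n : ℕ) (b c : Fin (n + 1) → ℝ)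
    (hb : ∀ i, 0 < b i) (hc : ∀ i, 0 < c i)
    {D : Set (Fin (n + 1) → ℝ)} (hD : MeasurableSet D) :
    Psi μ n (fun i => b i + c i) D ≤ Psi μ n b D * Psi μ n c D := by
  induction n with
  | zero =>
    exact (Real.rpow_add_of_nonneg ENNReal.toReal_nonneg (hb 0).le (hc 0).le).le
  | succ n ih =>
    have hb0 := hb 0
    have hc0 := hc 0
    set s := b 0 + c 0 with hs
    have hs0 : 0 < s := add_pos hb0 hc0
    let β : Fin (n + 1) → ℝ := fun i => b i.succ / b 0
    let γ : Fin (n + 1) → ℝ := fun i => c i.succ / c 0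
    have hβ : ∀ i, 0 < β i := fun i => div_pos (hb _) hb0
    have hγ : ∀ i, 0 < γ i := fun i => div_pos (hc _) hc0
    have hp : 0 < b 0 / s := div_pos hb0 hs0
    have hq : 0 < c 0 / s := div_pos hc0 hs0
    have hpq : b 0 / s + c 0 / s = 1 := by rw [← add_div, div_self hs0.ne']
    have hpt : ∀ x : ℝ, Psi μ n (fun i => (b i.succ + c i.succ) / s) {y | Fin.cons x y ∈ D} ≤
        Psi μ n β {y | Fin.cons x y ∈ D} ^ (b 0 / s) *
          Psi μ n γ {y | Fin.cons x y ∈ D} ^ (c 0 / s) := fun x => by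
      rw [← Psi_smul _ _ _ hp.ne', ← Psi_smul _ _ _ hq.ne']
      convert ih (fun i => b 0 / s * β i) (fun i => c 0 / s * γ i)
        (fun i => mul_pos hp (hβ i)) (fun i => mul_pos hq (hγ i))
        (measurableSet_cons_section hD x) using 3 with i
      simp only [β, γ]
      field_simp
    obtain ⟨hint, hle⟩ := integral_rpow_mul_rpow_le
      (integrable_Psi_cons μ n β (fun i => (hβ i).le) hD)
      (integrable_Psi_cons μ n γ (fun i => (hγ i).le) hD)
      (fun x => Psi_nonneg _ _ _ _) (fun x => Psi_nonneg _ _ _ _) hp.le hq.le hpq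
    have hB : 0 ≤ ∫ x, Psi μ n β {y | Fin.cons x y ∈ D} ∂μ :=
      integral_nonneg fun x => Psi_nonneg _ _ _ _
    have hC : 0 ≤ ∫ x, Psi μ n γ {y | Fin.cons x y ∈ D} ∂μ :=
      integral_nonneg fun x => Psi_nonneg _ _ _ _
    calc Psi μ (n + 1) (fun i => b i + c i) D
        ≤ ((∫ x, Psi μ n β {y | Fin.cons x y ∈ D} ∂μ) ^ (b 0 / s) *
            (∫ x, Psi μ n γ {y | Fin.cons x y ∈ D} ∂μ) ^ (c 0 / s)) ^ s :=
          Real.rpow_le_rpow (integral_nonneg fun x => Psi_nonneg _ _ _ _)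
            ((integral_mono_of_nonneg (ae_of_all _ fun x => Psi_nonneg _ _ _ _) hint
              (ae_of_all _ hpt)).trans hle) hs0.le
      _ = Psi μ (n + 1) b D * Psi μ (n + 1) c D := by
          rw [Real.mul_rpow (Real.rpow_nonneg hB _) (Real.rpow_nonneg hC _),
            ← Real.rpow_mul hB, ← Real.rpow_mul hC, div_mul_cancel₀ _ hs0.ne',
            div_mul_cancel₀ _ hs0.ne']
          rfl

lemma measurableSet_allPaths (n : ℕ) (A : Finset (List ℕ)) {D : Set (Fin n → ℝ)}
    (hD : MeasurableSet D) :
    MeasurableSet {ω : ↥(verts n A) → ℝ | ∀ a, ∀ ha : a ∈ A,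
      (fun i : Fin n => ω ⟨a.take (i.val + 1), take_mem_verts ha i.isLt⟩) ∈ D} := by
  simp only [Set.ofPred_forall]
  exact MeasurableSet.iInter fun a => MeasurableSet.iInter fun ha =>
    (measurable_pi_iff.2 fun i => measurable_pi_apply _) hD

lemma exists_take_one_eq_of_mem_verts {n : ℕ} {A : Finset (List ℕ)} {w : List ℕ}
    (hw : w ∈ verts n A) : ∃ a ∈ A, w.take 1 = a.take 1 := by
  obtain ⟨a, ha, hw⟩ := Finset.mem_biUnion.1 hw
  obtain ⟨i, -, rfl⟩ := Finset.mem_image.1 hw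
  exact ⟨a, ha, by simp [List.take_take]⟩

lemma levelCard_pos {A : Finset (List ℕ)} (hA : A.Nonempty) (i : ℕ) : 0 < levelCard A i :=
  Finset.card_pos.2 (hA.image _)

lemma levelCard_succ_filter_add (A : Finset (List ℕ)) (v : List ℕ) (i : ℕ) :
    levelCard (A.filter fun a => a.take 1 = v) (i + 1) +
      levelCard (A.filter fun a => ¬ a.take 1 = v) (i + 1) = levelCard A (i + 1) := by
  unfold levelCard
  rw [← Finset.card_union_of_disjoint, ← Finset.image_union, Finset.filter_union_filter_not_eq]
  refine Finset.disjoint_left.2 fun w h₁ h₂ => ?_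
  obtain ⟨a, ha, rfl⟩ := Finset.mem_image.1 h₁
  obtain ⟨a', ha', h⟩ := Finset.mem_image.1 h₂
  refine (Finset.mem_filter.1 ha').2 ?_
  rw [← (Finset.mem_filter.1 ha).2]
  simpa [List.take_take] using congrArg (List.take 1) h

section Independent

variable {Ω : Type*} [MeasurableSpace Ω] {P : Measure Ω}
  {X : List ℕ → Ω → ℝ}

/-- Subtrees with different first generations are labelled independently. -/
lemma measureReal_allPaths_filter_mul (hX : ∀ w, Measurable (X w)) (hind : iIndepFun X P)
    (n : ℕ) (A : Finset (List ℕ)) (v : List ℕ) {D : Set (Fin n → ℝ)} (hD : MeasurableSet D) :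
    P.real {ω | ∀ a ∈ A, (fun i : Fin n => X (a.take (i.val + 1)) ω) ∈ D} =
      P.real {ω | ∀ a ∈ A.filter (fun a => a.take 1 = v),
        (fun i : Fin n => X (a.take (i.val + 1)) ω) ∈ D} *
      P.real {ω | ∀ a ∈ A.filter (fun a => ¬ a.take 1 = v),
        (fun i : Fin n => X (a.take (i.val + 1)) ω) ∈ D} := by
  set A₁ := A.filter (fun a => a.take 1 = v) with hA₁
  set A₂ := A.filter (fun a => ¬ a.take 1 = v) with hA₂
  have hdisj : Disjoint (verts n A₁) (verts n A₂) := by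
    refine Finset.disjoint_left.2 fun w h₁ h₂ => ?_
    obtain ⟨a, ha, h⟩ := exists_take_one_eq_of_mem_verts h₁
    obtain ⟨a', ha', h'⟩ := exists_take_one_eq_of_mem_verts h₂
    exact (Finset.mem_filter.1 ha').2 (by rw [← h', h, (Finset.mem_filter.1 ha).2])
  have h := (hind.indepFun_finset _ _ hdisj hX).measure_inter_preimage_eq_mul _ _
    (measurableSet_allPaths n A₁ hD) (measurableSet_allPaths n A₂ hD)
  rw [measureReal_def, measureReal_def, measureReal_def, ← ENNReal.toReal_mul]
  congr 1
  refine Eq.trans (congrArg P ?_) h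
  rw [← Finset.filter_union_filter_not_eq (fun a => a.take 1 = v) A, ← hA₁, ← hA₂]
  ext ω
  simp only [Finset.mem_union, or_imp, forall_and]
  rfl

lemma Psi_le_allPaths_of_single_child [IsProbabilityMeasure P] {μ : Measure ℝ} [IsProbabilityMeasure μ]
    (hX : ∀ w, Measurable (X w)) (hind : iIndepFun X P)
    (n : ℕ) {D : Set (Fin (n + 1) → ℝ)} (hD : MeasurableSet D)
    (hsingle : ∀ A : Finset (List ℕ), A.Nonempty → (∀ a ∈ A, a.length = n + 1) →
      ∀ v, (∀ a ∈ A, a.take 1 = v) →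
      Psi μ n (fun i => (levelCard A (i.val + 1) : ℝ)) D ≤
        P.real {ω | ∀ a ∈ A, (fun i : Fin (n + 1) => X (a.take (i.val + 1)) ω) ∈ D})
    (A : Finset (List ℕ)) (hA : A.Nonempty) (hlen : ∀ a ∈ A, a.length = n + 1) :
    Psi μ n (fun i => (levelCard A (i.val + 1) : ℝ)) D ≤
      P.real {ω | ∀ a ∈ A, (fun i : Fin (n + 1) => X (a.take (i.val + 1)) ω) ∈ D} := by
  induction A using Finset.strongInduction with
  | H A ih =>
    obtain ⟨a, ha⟩ := hA
    set v := a.take 1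
    by_cases hv : ∀ a ∈ A, a.take 1 = v
    · exact hsingle A ⟨a, ha⟩ hlen v hv
    · push Not at hv
      obtain ⟨a', ha', hne⟩ := hv
      have h₁ : (A.filter fun a => a.take 1 = v).Nonempty := ⟨a, Finset.mem_filter.2 ⟨ha, rfl⟩⟩
      have h₂ : (A.filter fun a => ¬ a.take 1 = v).Nonempty :=
        ⟨a', Finset.mem_filter.2 ⟨ha', hne⟩⟩
      have hs₁ := Finset.filter_ssubset (p := fun a => a.take 1 = v).2 ⟨a', ha', hne⟩
      have hs₂ := Finset.filter_ssubset (p := fun a => ¬ a.take 1 = v).2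
        ⟨a, ha, fun h => h rfl⟩
      have k₁ := ih _ hs₁ h₁ fun a h => hlen a (hs₁.1 h)
      have k₂ := ih _ hs₂ h₂ fun a h => hlen a (hs₂.1 h)
      rw [measureReal_allPaths_filter_mul hX hind (n + 1) A v hD]
      refine le_trans ?_ (mul_le_mul k₁ k₂ (Psi_nonneg _ _ _ _) measureReal_nonneg)
      simp_rw [← levelCard_succ_filter_add A v, Nat.cast_add]
      exact Psi_add_le_mul μ n _ _ (fun i => Nat.cast_pos.2 (levelCard_pos h₁ _))
        (fun i => Nat.cast_pos.2 (levelCard_pos h₂ _)) hD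

/-- The label of a vertex is independent of the labels of its descendants. -/
lemma measureReal_allPaths_cons [IsProbabilityMeasure P] {μ : Measure ℝ} [IsProbabilityMeasure μ]
    (hX : ∀ w, Measurable (X w)) (hlaw : ∀ w, P.map (X w) = μ) (hind : iIndepFun X P)
    (n : ℕ) (A : Finset (List ℕ)) (hlen : ∀ a ∈ A, a.length = n) (v : ℕ)
    {D : Set (Fin (n + 1) → ℝ)} (hD : MeasurableSet D) :
    P.real {ω | ∀ a ∈ A, (Fin.cons (X [v] ω) fun i : Fin n => X (v :: a.take (i.val + 1)) ω :
        Fin (n + 1) → ℝ) ∈ D} =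
      ∫ x, P.real {ω | ∀ a ∈ A, (fun i : Fin n => X (v :: a.take (i.val + 1)) ω) ∈
        {y : Fin n → ℝ | (Fin.cons x y : Fin (n + 1) → ℝ) ∈ D}} ∂μ ∧
    Integrable (fun x => P.real {ω | ∀ a ∈ A, (fun i : Fin n => X (v :: a.take (i.val + 1)) ω) ∈
        {y : Fin n → ℝ | (Fin.cons x y : Fin (n + 1) → ℝ) ∈ D}}) μ := by
  let Y : Ω → ↥(verts n A) → ℝ := fun ω w => X (v :: w) ω
  have hY : Measurable Y := measurable_pi_iff.2 fun w => hX _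
  have hdisj : Disjoint {[v]} ((verts n A).image (List.cons v)) := by
    simp only [Finset.disjoint_singleton_left, Finset.mem_image, List.cons.injEq, true_and,
      exists_eq_right, verts, Finset.mem_biUnion, Finset.mem_range, not_exists, not_and]
    intro a ha i hi h
    obtain rfl : a = [] := by simpa using h
    exact absurd hi (by simp [← hlen [] ha])
  have hXY : IndepFun (X [v]) Y P := by
    have hφ : Measurable fun f : ↥({[v]} : Finset (List ℕ)) → ℝ => f ⟨[v], by simp⟩ :=
      measurable_pi_apply _
    have hψ : Measurable fun (f : ↥((verts n A).image (List.cons v)) → ℝ) (w : ↥(verts n A)) =>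
        f ⟨v :: w.1, Finset.mem_image_of_mem _ w.2⟩ :=
      measurable_pi_iff.2 fun w => measurable_pi_apply _
    exact (hind.indepFun_finset _ _ hdisj hX).comp hφ hψ
  let G : Set (ℝ × (↥(verts n A) → ℝ)) := {p | ∀ a, ∀ ha : a ∈ A,
    (Fin.cons p.1 fun i : Fin n => p.2 ⟨a.take (i.val + 1), take_mem_verts ha i.isLt⟩ :
      Fin (n + 1) → ℝ) ∈ D}
  have hG : MeasurableSet G := by
    simp only [G, Set.ofPred_forall]
    refine MeasurableSet.iInter fun a => MeasurableSet.iInter fun ha => ?_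
    exact ((measurable_fin_cons n).comp (by fun_prop :
      Measurable fun p : ℝ × (↥(verts n A) → ℝ) => (p.1, fun i : Fin n =>
        p.2 ⟨a.take (i.val + 1), take_mem_verts ha i.isLt⟩))) hD
  have hprod := (indepFun_iff_map_prod_eq_prod_map_map (hX [v]).aemeasurable
    hY.aemeasurable).1 hXY
  rw [hlaw] at hprod
  have hsec : ∀ x, P.map Y (Prod.mk x ⁻¹' G) =
      P {ω | ∀ a ∈ A, (fun i : Fin n => X (v :: a.take (i.val + 1)) ω) ∈
        {y : Fin n → ℝ | (Fin.cons x y : Fin (n + 1) → ℝ) ∈ D}} := fun x =>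
    Measure.map_apply hY (measurable_prodMk_left hG)
  have : IsProbabilityMeasure (P.map Y) := Measure.isProbabilityMeasure_map hY.aemeasurable
  have hmeas := measurable_measure_prodMk_left (ν := P.map Y) hG
  simp_rw [hsec] at hmeas
  have hE := Measure.map_apply (μ := P) ((hX [v]).prodMk hY) hG
  rw [hprod, Measure.prod_apply hG] at hE
  simp_rw [hsec] at hE
  constructor
  · rw [show (fun x => P.real {ω | ∀ a ∈ A, (fun i : Fin n => X (v :: a.take (i.val + 1)) ω) ∈
        {y : Fin n → ℝ | (Fin.cons x y : Fin (n + 1) → ℝ) ∈ D}}) = fun x => (P _).toReal from rfl,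
      integral_toReal hmeas.aemeasurable (ae_of_all _ fun x => measure_lt_top _ _), hE]
    rfl
  · exact Integrable.of_bound hmeas.ennreal_toReal.aestronglyMeasurable 1
      (ae_of_all _ fun x => by
        rw [Real.norm_of_nonneg measureReal_nonneg]
        exact measureReal_le_one)

lemma Psi_le_measureReal_allPaths [IsProbabilityMeasure P] {μ : Measure ℝ} [IsProbabilityMeasure μ]
    (hX : ∀ w, Measurable (X w)) (hlaw : ∀ w, P.map (X w) = μ) (hind : iIndepFun X P)
    (n : ℕ) {D : Set (Fin (n + 1) → ℝ)} (hD : MeasurableSet D)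
    (A : Finset (List ℕ)) (hA : A.Nonempty) (hlen : ∀ a ∈ A, a.length = n + 1) :
    Psi μ n (fun i => (levelCard A (i.val + 1) : ℝ)) D ≤
      P.real {ω | ∀ a ∈ A, (fun i : Fin (n + 1) => X (a.take (i.val + 1)) ω) ∈ D} := by
  induction n generalizing X A with
  | zero =>
    refine Psi_le_allPaths_of_single_child hX hind 0 hD (fun A hA hlen v hv => ?_) A hA hlen
    obtain ⟨a₀, ha₀⟩ := hA
    have hcard : levelCard A 1 = 1 := by
      rw [levelCard, Finset.image_congr (g := fun _ => v) (fun a ha => hv a ha),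
        Finset.image_const ⟨a₀, ha₀⟩, Finset.card_singleton]
    have hm : MeasurableSet {x : ℝ | (fun _ : Fin 1 => x) ∈ D} :=
      (measurable_pi_iff.2 fun _ => measurable_id) hD
    simp only [Psi, Fin.val_zero, zero_add, hcard, Nat.cast_one, Real.rpow_one]
    rw [← hlaw v, Measure.map_apply (hX v) hm]
    refine measureReal_mono (fun ω hω a ha => ?_)
    have heq : (fun i : Fin 1 => X (a.take (i.val + 1)) ω) = fun _ => X v ω :=
      funext fun i => by rw [Fin.val_eq_zero i, zero_add, hv a ha]
    exact heq ▸ hω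
  | succ n ih =>
    refine Psi_le_allPaths_of_single_child hX hind (n + 1) hD (fun A hA hlen v hv => ?_) A hA hlen
    obtain ⟨a₀, ha₀⟩ := hA
    obtain ⟨u, rfl⟩ : ∃ u, v = [u] := by
      rw [← List.length_eq_one_iff, ← hv a₀ ha₀, List.length_take, hlen a₀ ha₀]
      omega
    have hcons : ∀ a ∈ A, a = u :: a.tail := fun a ha => by
      have h := List.take_append_drop 1 a
      rw [hv a ha, List.drop_one] at h
      exact h.symm
    set A' := A.image List.tail with hA'
    have hA'ne : A'.Nonempty := ⟨_, Finset.mem_image_of_mem _ ha₀⟩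
    have hlen' : ∀ a ∈ A', a.length = n + 1 := by
      intro a ha
      obtain ⟨b, hb, rfl⟩ := Finset.mem_image.1 ha
      simp [hlen b hb]
    have hcard : ∀ i, levelCard A (i + 1) = levelCard A' i := fun i => by
      rw [levelCard, levelCard, ← Finset.card_image_of_injective (A'.image fun a => a.take i)
        (List.cons_injective (a := u)), hA', Finset.image_image, Finset.image_image]
      congr 1
      refine Finset.image_congr fun a ha => ?_
      conv_lhs => rw [hcons a ha]
      simp
    have hcard0 : levelCard A' 0 = 1 := by
      simp [levelCard, Finset.image_const hA'ne]
    obtain ⟨heq, hint⟩ := measureReal_allPaths_cons hX hlaw hind (n + 1) A' hlen' u hD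
    have hevent : {ω | ∀ a ∈ A, (fun i : Fin (n + 1 + 1) => X (a.take (i.val + 1)) ω) ∈ D} =
        {ω | ∀ a ∈ A', (Fin.cons (X [u] ω) fun i : Fin (n + 1) =>
          X (u :: a.take (i.val + 1)) ω : Fin (n + 2) → ℝ) ∈ D} := by
      ext ω
      simp only [hA', Set.mem_ofPred_eq, Finset.forall_mem_image]
      refine forall₂_congr fun a ha => ?_
      conv_lhs => rw [hcons a ha]
      refine iff_of_eq (congrArg (· ∈ D) (funext fun i => ?_))
      refine Fin.cases ?_ (fun j => ?_) i <;> simp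
    rw [hevent, heq]
    simp only [Psi, hcard, Fin.val_zero, hcard0, Nat.cast_one, Real.rpow_one, div_one,
      Fin.val_succ]
    exact integral_mono_of_nonneg (ae_of_all _ fun x => Psi_nonneg _ _ _ _) hint
      (ae_of_all _ fun x => ih (X := fun w => X (u :: w)) (fun w => hX _) (fun w => hlaw _)
        (hind.precomp List.cons_injective) (measurableSet_cons_section hD x) A' hA'ne hlen')

end Independent

/-- for any finite tree `T` of height `n` with generation cardinalities
`bᵢ = |Tᵢ|`, the probability `φ(T; D)` that every root-to-leaf path lies in `D` is at
least `Ψ(b₁,…,bₙ; D)`. -/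
theorem allPathProb_ge_psi (μ : Measure ℝ) [IsProbabilityMeasure μ]
    (n : ℕ) (A : Finset (List ℕ)) (hA : A.Nonempty)
    (hlen : ∀ a ∈ A, a.length = n + 1)
    (D : Set (Fin (n + 1) → ℝ)) (hD : MeasurableSet D) :
    Psi μ n (fun i => (levelCard A (i.val + 1) : ℝ)) D ≤ allPathProb μ (n + 1) A D := by
  have hlaw : ∀ w : List ℕ,
      (Measure.infinitePi fun _ : List ℕ => μ).map (fun ω => ω w) = μ :=
    fun w => Measure.infinitePi_map_eval _ w
  have h := Psi_le_measureReal_allPaths (fun w : List ℕ => measurable_pi_apply w) hlaw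
    (iIndepFun_infinitePi (X := fun _ x => x) fun _ => measurable_id) n hD A hA hlen
  refine h.trans_eq ?_
  rw [allPathProb, ← Measure.infinitePi_map_restrict (μ := fun _ : List ℕ => μ),
    Measure.map_apply (Finset.measurable_restrict _) (measurableSet_allPaths (n + 1) A hD)]
  rfl
end

section
/- Let Γ be a spherically symmetric tree and Γ' an arbitrary rooted tree. Then Γ dominates Γ' if and only if |Γₙ| ≥ |Γ'ₙ| for every n ≥ 1, where Γₙ denotes the set of vertices at distance n from the root. -/
open MeasureTheory ProbabilityTheory Filter Finset

/-- level-`n` vertex set of the spherically symmetric tree with growth function `f`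
(each vertex at distance `n-1` from the root has `f n` children). -/
def sphA (f : ℕ → ℕ) : ℕ → Finset (List ℕ)
  | 0 => {[]}
  | n + 1 => (sphA f n).biUnion fun l => (Finset.range (f (n + 1))).image fun j => l ++ [j]

/-- A rooted tree, encoded by its levels: `A n` is the set of vertices at distance `n`
from the root, each identified with its address list. -/
structure TreeSeq where
  A : ℕ → Finset (List ℕ)
  root : A 0 = {[]}
  len : ∀ n, ∀ l ∈ A n, l.length = n
  coh : ∀ n, ∀ l ∈ A (n + 1), l.take n ∈ A n

/-- `Γ` dominates `Γ'`: for every common label law `μ`, every `n ≥ 1` and every Borel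
`B ⊆ ℝⁿ`, the probability that some length-`n` path from the root of `Γ` has its label
sequence in `B` is at least the corresponding probability for `Γ'`. -/
def Dominates (Γ Γ' : TreeSeq) : Prop :=
  ∀ (μ : Measure ℝ), IsProbabilityMeasure μ → ∀ (n : ℕ) (B : Set (Fin (n + 1) → ℝ)),
    MeasurableSet B → pathProb μ (n + 1) (Γ'.A (n + 1)) B ≤ pathProb μ (n + 1) (Γ.A (n + 1)) B

open scoped ENNReal

/-- The law of an i.i.d. labeling of all address lists. -/
noncomputable def labelLaw (μ : Measure ℝ) : Measure (List ℕ → ℝ) :=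
  Measure.infinitePi fun _ => μ

instance (μ : Measure ℝ) [IsProbabilityMeasure μ] : IsProbabilityMeasure (labelLaw μ) := by
  unfold labelLaw; infer_instance

/-- The labels read along the path from (but excluding) the root to `a`. -/
def pathLabels (n : ℕ) (a : List ℕ) (ω : List ℕ → ℝ) : Fin n → ℝ :=
  fun i => ω (a.take (i + 1))

/-- The event that every path ending in `A` has its label sequence in `D`. -/
def allPathsIn (n : ℕ) (A : Finset (List ℕ)) (D : Set (Fin n → ℝ)) : Set (List ℕ → ℝ) :=
  {ω | ∀ a ∈ A, pathLabels n a ω ∈ D}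

/-- The leaves of the subtree rooted at the child `c` of the root. -/
noncomputable def childLeaves (A : Finset (List ℕ)) (c : ℕ) : Finset (List ℕ) :=
  A.preimage (List.cons c) (List.cons_injective.injOn)

@[simp] lemma mem_childLeaves {A : Finset (List ℕ)} {c : ℕ} {l : List ℕ} :
    l ∈ childLeaves A c ↔ c :: l ∈ A := by
  simp [childLeaves]

/-- The labeling with root label `x` and labels `η c` on the subtree of the child `c`. -/
def glueLabels (p : ℝ × (ℕ → List ℕ → ℝ)) : List ℕ → ℝ
  | [] => p.1
  | c :: l => p.2 c l

lemma measurable_pathLabels (n : ℕ) (a : List ℕ) : Measurable (pathLabels n a) := by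
  unfold pathLabels; fun_prop

lemma measurable_glueLabels : Measurable glueLabels := by
  refine measurable_pi_lambda _ fun l => ?_
  cases l with
  | nil => exact measurable_fst
  | cons c l => simp only [glueLabels]; fun_prop

lemma measurableSet_allPathsIn {n : ℕ} (A : Finset (List ℕ)) {D : Set (Fin n → ℝ)}
    (hD : MeasurableSet D) : MeasurableSet (allPathsIn n A D) := by
  have : allPathsIn n A D = ⋂ a ∈ A, pathLabels n a ⁻¹' D := by
    ext; simp [allPathsIn]
  rw [this]
  exact A.measurableSet_biInter fun a _ => measurable_pathLabels n a hD

lemma injective_cons_uncurried :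
    Function.Injective fun p : ℕ × List ℕ => p.1 :: p.2 := by
  rintro ⟨c, l⟩ ⟨c', l'⟩ h
  simpa using h

lemma prod_list_eq {M : Type*} [CommMonoid M] (s : Finset (List ℕ)) (g : List ℕ → M) :
    ∏ l ∈ s, g l = (if [] ∈ s then g [] else 1) *
      ∏ p ∈ s.preimage (fun p : ℕ × List ℕ => p.1 :: p.2)
        injective_cons_uncurried.injOn, g (p.1 :: p.2) := by
  classical
  rw [Finset.prod_preimage' (fun p : ℕ × List ℕ => p.1 :: p.2) s _ g,
    ← Finset.prod_filter_mul_prod_filter_not s (· = []), Finset.prod_filter,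
    Finset.prod_ite_eq']
  congr 2
  ext l
  cases l <;> simp

lemma map_glueLabels (μ : Measure ℝ) [IsProbabilityMeasure μ] :
    (μ.prod (Measure.infinitePi fun _ : ℕ => labelLaw μ)).map glueLabels = labelLaw μ := by
  refine Measure.eq_infinitePi _ fun s t ht => ?_
  set s' := s.preimage (fun p : ℕ × List ℕ => p.1 :: p.2)
        injective_cons_uncurried.injOn with hs'
  have hpre : glueLabels ⁻¹' Set.pi s t = (if [] ∈ s then t [] else Set.univ) ×ˢ
      ((MeasurableEquiv.curry ℕ (List ℕ) ℝ).symm ⁻¹'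
        Set.pi s' fun p : ℕ × List ℕ => t (p.1 :: p.2)) := by
    ext ⟨x, η⟩
    simp only [Set.mem_preimage, Set.mem_pi, Set.mem_prod, hs', Finset.mem_coe,
      Finset.mem_preimage]
    constructor
    · intro h
      refine ⟨?_, fun p hp => h _ hp⟩
      split_ifs with h0
      · exact h _ h0
      · trivial
    · rintro ⟨h1, h2⟩ l hl
      cases l with
      | nil => simpa [hl, glueLabels] using h1
      | cons c l => exact h2 (c, l) hl
  have hm : MeasurableSet (Set.pi (s' : Set (ℕ × List ℕ)) fun p => t (p.1 :: p.2)) :=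
    .pi s'.countable_toSet fun _ _ => ht _
  rw [Measure.map_apply measurable_glueLabels (.pi s.countable_toSet fun _ _ => ht _), hpre,
    Measure.prod_prod, ← Measure.map_apply (MeasurableEquiv.measurable _) hm]
  unfold labelLaw
  rw [Measure.infinitePi_map_curry_symm (fun _ _ => μ), Measure.infinitePi_pi _ fun _ _ => ht _,
    prod_list_eq s fun i => μ (t i)]
  congr 1
  split_ifs <;> simp

/-- The labelSlice of `D` with first coordinate `x`. -/
def labelSlice {n : ℕ} (D : Set (Fin (n + 1) → ℝ)) (x : ℝ) : Set (Fin n → ℝ) :=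
  {v | Fin.cons x v ∈ D}

lemma measurable_finCons {n : ℕ} :
    Measurable fun p : ℝ × (Fin n → ℝ) => (Fin.cons p.1 p.2 : Fin (n + 1) → ℝ) := by
  refine measurable_pi_lambda _ fun i => ?_
  refine Fin.cases ?_ (fun j => ?_) i
  · simpa using measurable_fst
  · simp only [Fin.cons_succ]; fun_prop

lemma measurableSet_labelSlice {n : ℕ} {D : Set (Fin (n + 1) → ℝ)} (hD : MeasurableSet D) (x : ℝ) :
    MeasurableSet (labelSlice D x) :=
  (measurable_finCons.comp measurable_prodMk_left) hD

lemma pathLabels_glueLabels {n : ℕ} {l : List ℕ} (hl : n ≤ l.length) (x y : ℝ)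
    (η : ℕ → List ℕ → ℝ) :
    pathLabels n l (glueLabels (x, η)) = pathLabels n l (glueLabels (y, η)) := by
  ext i
  cases l with
  | nil => simp at hl; subst hl; exact i.elim0
  | cons c l => simp [pathLabels, glueLabels]

lemma measurableSet_prod_labelSlice {n : ℕ} (A : Finset (List ℕ)) {D : Set (Fin (n + 1) → ℝ)}
    (hD : MeasurableSet D) :
    MeasurableSet {p : ℝ × (List ℕ → ℝ) | p.2 ∈ allPathsIn n A (labelSlice D p.1)} := by
  have : {p : ℝ × (List ℕ → ℝ) | p.2 ∈ allPathsIn n A (labelSlice D p.1)} =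
      ⋂ a ∈ A, (fun p : ℝ × (List ℕ → ℝ) =>
        (Fin.cons p.1 (pathLabels n a p.2) : Fin (n + 1) → ℝ)) ⁻¹' D := by
    ext; simp [allPathsIn, labelSlice]
  rw [this]
  refine A.measurableSet_biInter fun a _ => ?_
  exact (measurable_finCons.comp
    (measurable_fst.prodMk ((measurable_pathLabels n a).comp measurable_snd))) hD

lemma measurableSet_root_labelSlice {n : ℕ} (A : Finset (List ℕ)) {D : Set (Fin (n + 1) → ℝ)}
    (hD : MeasurableSet D) :
    MeasurableSet {ω : List ℕ → ℝ | ω ∈ allPathsIn n A (labelSlice D (ω []))} := by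
  have hm : Measurable fun ω : List ℕ → ℝ => (ω [], ω) :=
    (measurable_pi_apply []).prodMk measurable_id
  exact hm (measurableSet_prod_labelSlice A hD)

lemma measurable_labelLaw_labelSlice (μ : Measure ℝ) [IsProbabilityMeasure μ] {n : ℕ}
    (A : Finset (List ℕ)) {D : Set (Fin (n + 1) → ℝ)} (hD : MeasurableSet D) :
    Measurable fun x => labelLaw μ (allPathsIn n A (labelSlice D x)) :=
  measurable_measure_prodMk_left (measurableSet_prod_labelSlice A hD)

/-- The root label is independent of the labels read along the paths below the root. -/
lemma labelLaw_rooted (μ : Measure ℝ) [IsProbabilityMeasure μ] {n : ℕ} {A : Finset (List ℕ)}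
    (hA : ∀ a ∈ A, n ≤ a.length) {D : Set (Fin (n + 1) → ℝ)} (hD : MeasurableSet D) :
    labelLaw μ {ω | ω ∈ allPathsIn n A (labelSlice D (ω []))} =
      ∫⁻ x, labelLaw μ (allPathsIn n A (labelSlice D x)) ∂μ := by
  have key (E : Set (List ℕ → ℝ)) (hE : MeasurableSet E) : labelLaw μ E =
      ∫⁻ x, (Measure.infinitePi fun _ : ℕ => labelLaw μ) {η | glueLabels (x, η) ∈ E} ∂μ := by
    rw [← map_glueLabels μ, Measure.map_apply measurable_glueLabels hE, Measure.prod_apply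
      (measurable_glueLabels hE), map_glueLabels]
    rfl
  rw [key _ (measurableSet_root_labelSlice A hD)]
  refine lintegral_congr fun x => ?_
  rw [key _ (measurableSet_allPathsIn A (measurableSet_labelSlice hD x))]
  have (y : ℝ) : {η | glueLabels (y, η) ∈ allPathsIn n A (labelSlice D x)} =
      {η | glueLabels (x, η) ∈ allPathsIn n A (labelSlice D x)} := by
    ext η
    refine forall₂_congr fun a ha => ?_
    rw [pathLabels_glueLabels (hA a ha) y x]
  simp_rw [this]
  simp [glueLabels]

/-- Conditioning on the labels of the children of the root. -/
lemma labelLaw_allPathsIn_succ (μ : Measure ℝ) [IsProbabilityMeasure μ] {n : ℕ}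
    {A : Finset (List ℕ)} (hA : ∀ a ∈ A, a.length = n + 1) {H : Finset ℕ}
    (hH : ∀ c l, c :: l ∈ A → c ∈ H) {D : Set (Fin (n + 1) → ℝ)} (hD : MeasurableSet D) :
    labelLaw μ (allPathsIn (n + 1) A D) =
      ∏ c ∈ H, ∫⁻ x, labelLaw μ (allPathsIn n (childLeaves A c) (labelSlice D x)) ∂μ := by
  have hpre : glueLabels ⁻¹' allPathsIn (n + 1) A D = Set.univ ×ˢ Set.pi H fun c =>
      {ω | ω ∈ allPathsIn n (childLeaves A c) (labelSlice D (ω []))} := by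
    ext ⟨x, η⟩
    have hp (c : ℕ) (l : List ℕ) : pathLabels (n + 1) (c :: l) (glueLabels (x, η)) =
        Fin.cons (η c []) (pathLabels n l (η c)) := by
      ext i
      refine Fin.cases ?_ (fun j => ?_) i <;> simp [pathLabels, glueLabels]
    simp only [Set.mem_preimage, allPathsIn, Set.mem_ofPred_eq, Set.mem_prod, Set.mem_univ,
      true_and, Set.mem_pi, Finset.mem_coe, mem_childLeaves, labelSlice]
    constructor
    · intro h c _ l hl
      simpa [hp] using h _ hl
    · intro h a ha
      cases a with
      | nil => simpa using hA _ ha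
      | cons c l => simpa [hp] using h c (hH c l ha) l ha
  rw [← map_glueLabels μ, Measure.map_apply measurable_glueLabels
    (measurableSet_allPathsIn A hD), hpre, Measure.prod_prod, measure_univ, one_mul,
    Measure.infinitePi_pi _ fun c _ => measurableSet_root_labelSlice _ hD, map_glueLabels]
  refine Finset.prod_congr rfl fun c _ => labelLaw_rooted μ (fun a ha => ?_) hD
  simpa using (hA _ (mem_childLeaves.1 ha)).ge

lemma pathProb_eq (μ : Measure ℝ) [IsProbabilityMeasure μ] (n : ℕ) (A : Finset (List ℕ))
    {B : Set (Fin n → ℝ)} (hB : MeasurableSet B) :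
    pathProb μ n A B = 1 - (labelLaw μ (allPathsIn n A Bᶜ)).toReal := by
  have hE : MeasurableSet (⋃ a : A, {ω : verts n A → ℝ |
      (fun i : Fin n => ω ⟨a.1.take (i.val + 1), take_mem_verts a.2 i.isLt⟩) ∈ B}) := by
    refine .iUnion fun a => ?_
    exact (show Measurable fun (ω : verts n A → ℝ) (i : Fin n) =>
      ω ⟨a.1.take (i.val + 1), take_mem_verts a.2 i.isLt⟩ by fun_prop) hB
  have hE' : {ω : verts n A → ℝ | ∃ a, ∃ ha : a ∈ A,
      (fun i : Fin n => ω ⟨a.take (i.val + 1), take_mem_verts ha i.isLt⟩) ∈ B} =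
      ⋃ a : A, {ω : verts n A → ℝ |
      (fun i : Fin n => ω ⟨a.1.take (i.val + 1), take_mem_verts a.2 i.isLt⟩) ∈ B} := by
    ext; simp
  have hc : (allPathsIn n A Bᶜ)ᶜ = (verts n A).restrict ⁻¹' ⋃ a : A, {ω : verts n A → ℝ |
      (fun i : Fin n => ω ⟨a.1.take (i.val + 1), take_mem_verts a.2 i.isLt⟩) ∈ B} := by
    ext ω
    simp [allPathsIn, Finset.restrict_def]
    rfl
  have hm := measurableSet_allPathsIn A hB.compl
  rw [pathProb, hE', ← Measure.infinitePi_map_restrict (fun _ : List ℕ => μ),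
    Measure.map_apply (by fun_prop) hE, ← hc]
  change (labelLaw μ).real _ = 1 - (labelLaw μ).real _
  rw [measureReal_compl hm]
  simp

lemma mem_sphA {f : ℕ → ℕ} {n : ℕ} {l : List ℕ} :
    l ∈ sphA f n ↔ l.length = n ∧ ∀ i (h : i < l.length), l[i] < f (i + 1) := by
  induction n generalizing l with
  | zero => simp +contextual [sphA]
  | succ n ih =>
    simp only [sphA, Finset.mem_biUnion, Finset.mem_image, Finset.mem_range, ih]
    constructor
    · rintro ⟨l, ⟨hl, h⟩, j, hj, rfl⟩
      refine ⟨by simpa using hl, fun i hi => ?_⟩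
      by_cases hil : i < l.length
      · simpa [List.getElem_append_left hil] using h i hil
      · have : i = l.length := by simp at hi; omega
        subst this
        simpa [hl] using hj
    · rintro ⟨hl, h⟩
      have hne : l ≠ [] := by rintro rfl; simp at hl
      refine ⟨l.dropLast, ⟨by simp [hl], fun i hi => ?_⟩, l.getLast hne, ?_,
        List.dropLast_append_getLast hne⟩
      · simpa using h i (by simp at hi; omega)
      · have := h n (by omega)
        simpa [List.getLast_eq_getElem, hl] using this

lemma card_sphA (f : ℕ → ℕ) (n : ℕ) : (sphA f n).card = ∏ i ∈ Finset.range n, f (i + 1) := by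
  induction n with
  | zero => simp [sphA]
  | succ n ih =>
    rw [sphA, Finset.card_biUnion, Finset.prod_range_succ, ← ih]
    · rw [Finset.sum_congr rfl (g := fun _ => f (n + 1))]
      · simp
      · intro l _
        rw [Finset.card_image_of_injective _ fun i j h => by simpa using h, Finset.card_range]
    · intro l _ l' _ hne
      rw [Function.onFun, Finset.disjoint_left]
      simp only [Finset.mem_image]
      rintro _ ⟨j, _, rfl⟩ ⟨j', _, h⟩
      exact hne (List.append_inj' h rfl).1.symm

lemma childLeaves_sphA {f : ℕ → ℕ} {n c : ℕ} (hc : c < f 1) :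
    childLeaves (sphA f (n + 1)) c = sphA (fun i => f (i + 1)) n := by
  ext l
  simp only [mem_childLeaves, mem_sphA, List.length_cons, add_left_inj]
  refine and_congr_right fun _ => ⟨fun h i hi => h (i + 1) (by simpa using hi), ?_⟩
  rintro h (_ | i) hi
  · simpa using hc
  · simpa using h i (by omega)

lemma labelLaw_sphA_succ (μ : Measure ℝ) [IsProbabilityMeasure μ] (f : ℕ → ℕ) {n : ℕ}
    {D : Set (Fin (n + 1) → ℝ)} (hD : MeasurableSet D) :
    labelLaw μ (allPathsIn (n + 1) (sphA f (n + 1)) D) =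
      (∫⁻ x, labelLaw μ (allPathsIn n (sphA (fun i => f (i + 1)) n) (labelSlice D x)) ∂μ) ^ f 1 := by
  rw [labelLaw_allPathsIn_succ μ (fun a ha => (mem_sphA.1 ha).1) (H := Finset.range (f 1)) _ hD,
    Finset.prod_congr rfl (fun c hc => by rw [childLeaves_sphA (Finset.mem_range.1 hc)])]
  · simp
  · intro c l h
    exact Finset.mem_range.2 ((mem_sphA.1 h).2 0 (by simp))

/-- The children of the root. -/
def rootChildren (A : Finset (List ℕ)) : Finset ℕ :=
  (A.image (List.take 1)).image fun l => l.headD 0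

lemma mem_rootChildren {A : Finset (List ℕ)} {c : ℕ} {l : List ℕ} (h : c :: l ∈ A) :
    c ∈ rootChildren A :=
  Finset.mem_image.2 ⟨[c], Finset.mem_image.2 ⟨_, h, by simp⟩, rfl⟩

lemma sum_card_childLeaves_le (A : Finset (List ℕ)) (H : Finset ℕ) (j : ℕ) :
    ∑ c ∈ H, ((childLeaves A c).image (List.take j)).card ≤ (A.image (List.take (j + 1))).card := by
  classical
  calc ∑ c ∈ H, ((childLeaves A c).image (List.take j)).card
      = (H.sigma fun c => (childLeaves A c).image (List.take j)).card := by
        rw [Finset.card_sigma]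
    _ ≤ _ := by
      refine Finset.card_le_card_of_injOn (fun p => p.1 :: p.2) ?_ ?_
      · rintro ⟨c, l⟩ h
        simp only [Finset.coe_sigma, Set.mem_sigma_iff, Finset.mem_coe, Finset.mem_image,
          mem_childLeaves] at h
        obtain ⟨_, l', hl', rfl⟩ := h
        exact Finset.mem_coe.2 (Finset.mem_image.2 ⟨_, hl', by simp⟩)
      · rintro ⟨c, l⟩ _ ⟨c', l'⟩ _ h
        simp only [List.cons.injEq] at h
        obtain ⟨rfl, rfl⟩ := h
        rfl

/-- If `h ^ m` is at most a product of at most `m` functions bounded by one, then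
the same inequality holds for the integrals. -/
lemma lintegral_pow_le_prod_lintegral {α ι : Type*} [MeasurableSpace α] (μ : Measure α)
    [IsProbabilityMeasure μ] (s : Finset ι) {g : ι → α → ℝ≥0∞} {h : α → ℝ≥0∞} {m : ℕ}
    (hs : s.card ≤ m) (hg : ∀ i ∈ s, Measurable (g i))
    (hh : ∀ x, h x ^ m ≤ ∏ i ∈ s, g i x) :
    (∫⁻ x, h x ∂μ) ^ m ≤ ∏ i ∈ s, ∫⁻ x, g i x ∂μ := by
  rcases Nat.eq_zero_or_pos m with rfl | hm
  · simp [Finset.card_eq_zero.1 (Nat.le_zero.1 hs)]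
  have hm' : (0 : ℝ) < m := by exact_mod_cast hm
  have hroot (x : ℝ≥0∞) : (x ^ m) ^ (m : ℝ)⁻¹ = x := by
    rw [← ENNReal.rpow_natCast, ENNReal.rpow_rpow_inv hm'.ne']
  have hroot' (x : ℝ≥0∞) : (x ^ (m : ℝ)⁻¹) ^ m = x := by
    rw [← ENNReal.rpow_natCast, ENNReal.rpow_inv_rpow hm'.ne']
  have hle : ∫⁻ x, h x ∂μ ≤ ∏ i ∈ s, (∫⁻ x, g i x ∂μ) ^ (m : ℝ)⁻¹ := by
    have hcard : (s.card : ℝ) * (m : ℝ)⁻¹ ≤ 1 := by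
      rw [← div_eq_mul_inv, div_le_one hm']; exact_mod_cast hs
    have := ENNReal.lintegral_mul_prod_norm_pow_le (μ := μ) s (g := fun _ => 1) (f := g)
      aemeasurable_const (fun i hi => (hg i hi).aemeasurable) (1 - s.card * (m : ℝ)⁻¹)
      (p := fun _ => (m : ℝ)⁻¹) (by simp) (by linarith) (fun _ _ => by positivity)
    simp only [ENNReal.one_rpow, one_mul, lintegral_const, measure_univ] at this
    refine (lintegral_mono fun x => ?_).trans this
    rw [ENNReal.prod_rpow_of_nonneg (by positivity), ← hroot (h x)]
    exact ENNReal.rpow_le_rpow (hh x) (by positivity)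
  calc (∫⁻ x, h x ∂μ) ^ m ≤ (∏ i ∈ s, (∫⁻ x, g i x ∂μ) ^ (m : ℝ)⁻¹) ^ m := by gcongr
    _ = _ := by rw [← Finset.prod_pow]; simp_rw [hroot']

/-- A finite forest whose level sizes are at most those of `m` copies of a spherically symmetric
tree has all its paths in `D` with at least the probability for these copies. -/
lemma sphA_pow_le_prod (μ : Measure ℝ) [IsProbabilityMeasure μ] (n : ℕ) {ι : Type}
    (s : Finset ι) (A : ι → Finset (List ℕ)) (f : ℕ → ℕ) (m : ℕ)
    (hA : ∀ i ∈ s, ∀ a ∈ A i, a.length = n)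
    (hcard : ∀ j ≤ n, ∑ i ∈ s, ((A i).image (List.take j)).card ≤
      m * ∏ k ∈ Finset.range j, f (k + 1))
    {D : Set (Fin n → ℝ)} (hD : MeasurableSet D) :
    labelLaw μ (allPathsIn n (sphA f n) D) ^ m ≤
      ∏ i ∈ s, labelLaw μ (allPathsIn n (A i) D) := by
  classical
  induction n generalizing ι s A f m with
  | zero =>
    by_cases hD0 : (Fin.elim0 : Fin 0 → ℝ) ∈ D
    · have (A : Finset (List ℕ)) : allPathsIn 0 A D = Set.univ := by
        ext ω
        simp only [allPathsIn, Set.mem_ofPred_eq, Set.mem_univ, iff_true]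
        intro a _
        rwa [Subsingleton.elim (pathLabels 0 a ω) Fin.elim0]
      simp [this]
    · rcases Nat.eq_zero_or_pos m with rfl | hm
      · have hE : ∀ i ∈ s, A i = ∅ := by simpa using hcard 0 le_rfl
        rw [Finset.prod_eq_one fun i hi => by simp [hE i hi, allPathsIn]]
        simp
      · have : allPathsIn 0 (sphA f 0) D = ∅ := by
          ext ω
          simp only [allPathsIn, sphA, Finset.mem_singleton, forall_eq, Set.mem_ofPred_eq,
            Set.mem_empty_iff_false, iff_false]
          rwa [Subsingleton.elim (pathLabels 0 [] ω) Fin.elim0]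
        simp [this, hm.ne']
  | succ n ih =>
    have hprod (i) (hi : i ∈ s) := labelLaw_allPathsIn_succ μ (hA i hi)
      (H := rootChildren (A i)) (fun c l => mem_rootChildren) hD
    rw [labelLaw_sphA_succ μ f hD, ← pow_mul, Finset.prod_congr rfl hprod, Finset.prod_sigma']
    refine lintegral_pow_le_prod_lintegral μ _ ?_
      (fun p _ => measurable_labelLaw_labelSlice μ (childLeaves (A p.1) p.2) hD) fun x => ?_
    · calc (s.sigma fun i => rootChildren (A i)).card
          = ∑ i ∈ s, (rootChildren (A i)).card := Finset.card_sigma _ _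
        _ ≤ ∑ i ∈ s, ((A i).image (List.take 1)).card :=
          Finset.sum_le_sum fun i _ => Finset.card_image_le
        _ ≤ f 1 * m := by simpa [mul_comm] using hcard 1 (by omega)
    · refine ih (s.sigma fun i => rootChildren (A i)) (fun p => childLeaves (A p.1) p.2)
        (fun i => f (i + 1)) _ ?_ ?_ (measurableSet_labelSlice hD x)
      · rintro ⟨i, c⟩ hp a ha
        simpa using hA i (Finset.mem_sigma.1 hp).1 _ (mem_childLeaves.1 ha)
      · intro j hj
        rw [Finset.sum_sigma]
        refine (Finset.sum_le_sum fun i _ => sum_card_childLeaves_le (A i) _ j).trans ?_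
        refine (hcard (j + 1) (by omega)).trans_eq ?_
        rw [Finset.prod_range_succ']
        ring

lemma TreeSeq.take_mem (Γ : TreeSeq) {n : ℕ} {l : List ℕ} (hl : l ∈ Γ.A n) {j : ℕ} (hj : j ≤ n) :
    l.take j ∈ Γ.A j := by
  induction n, hj using Nat.le_induction generalizing l with
  | base => rwa [List.take_of_length_le (Γ.len _ _ hl).le]
  | succ n hjn ih => simpa [List.take_take, hjn] using ih (Γ.coh n l hl)

/-- With fair coin labels, a path ending in a head exists unless all leaves show tails. -/
lemma pathProb_coin {n : ℕ} {A : Finset (List ℕ)} (hA : ∀ a ∈ A, a.length = n + 1) :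
    pathProb ((2⁻¹ : ℝ≥0∞) • Measure.dirac 0 + (2⁻¹ : ℝ≥0∞) • Measure.dirac 1) (n + 1) A
      {v | v (Fin.last n) = 1} = 1 - (2⁻¹ : ℝ) ^ A.card := by
  set μ : Measure ℝ := (2⁻¹ : ℝ≥0∞) • Measure.dirac 0 + (2⁻¹ : ℝ≥0∞) • Measure.dirac 1
  have : IsProbabilityMeasure μ := ⟨by simp [μ, ENNReal.inv_two_add_inv_two]⟩
  have hE : allPathsIn (n + 1) A {v | v (Fin.last n) = 1}ᶜ = Set.pi A fun _ => ({1} : Set ℝ)ᶜ := by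
    ext ω
    refine forall₂_congr fun a ha => ?_
    simp [pathLabels, List.take_of_length_le (hA a ha).le]
  have hμ : μ ({1} : Set ℝ)ᶜ = 2⁻¹ := by
    simp [μ]
  rw [pathProb_eq μ (n + 1) A (measurableSet_eq_fun (by fun_prop) (by fun_prop)), hE, labelLaw,
    Measure.infinitePi_pi _ fun _ _ => (measurableSet_singleton 1).compl]
  simp [hμ]

/-- a spherically symmetric tree `Γ` dominates an arbitrary tree `Γ'` if
and only if every generation of `Γ` is at least as big as that of `Γ'`. -/
theorem spherically_symmetric_domination_iff (f : ℕ → ℕ)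
    (Γ Γ' : TreeSeq) (hΓ : ∀ n, Γ.A n = sphA f n) :
    Dominates Γ Γ' ↔ ∀ n : ℕ, 1 ≤ n → (Γ'.A n).card ≤ (Γ.A n).card := by
  constructor
  · rintro hdom (_ | n) hn
    · omega
    have h := hdom ((2⁻¹ : ℝ≥0∞) • Measure.dirac 0 + (2⁻¹ : ℝ≥0∞) • Measure.dirac 1)
      ⟨by simp [ENNReal.inv_two_add_inv_two]⟩ n {v | v (Fin.last n) = 1}
      (measurableSet_eq_fun (by fun_prop) (by fun_prop))
    rw [pathProb_coin (Γ.len _), pathProb_coin (Γ'.len _), sub_le_sub_iff_left] at h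
    exact (pow_le_pow_iff_right_of_lt_one₀ (by norm_num) (by norm_num)).1 h
  · intro hcard μ _ n B hB
    rw [pathProb_eq μ _ _ hB, pathProb_eq μ _ _ hB, hΓ]
    refine sub_le_sub_left (ENNReal.toReal_mono (measure_ne_top _ _) ?_) _
    have := sphA_pow_le_prod μ (n + 1) (Finset.univ : Finset Unit) (fun _ => Γ'.A (n + 1)) f 1
      (fun _ _ => Γ'.len _) (fun j hj => ?_) hB.compl
    · simpa using this
    · rw [← card_sphA, ← hΓ, one_mul, Fintype.sum_unique]
      refine (Finset.card_le_card (t := Γ'.A j) ?_).trans ?_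
      · intro l hl
        obtain ⟨l', hl', rfl⟩ := Finset.mem_image.1 hl
        exact Γ'.take_mem hl' hj
      · cases j with
        | zero => simp [Γ.root, Γ'.root]
        | succ j => exact hcard _ (by omega)
end

section
/- Let Γ and Γ' be rooted trees of height 2 with decreasing sequences of children-counts (n₁ ≥ ... ≥ n_b) and (n₁' ≥ ... ≥ n_b') of their first-generation vertices (padding with zeros to equal length). Then Γ dominates Γ' if and only if for every k ≥ 0, Σ_{i>k} nᵢ ≥ Σ_{i>k} nᵢ'. -/
open MeasureTheory ProbabilityTheory Filter Finset

/-- the height-2 tree whose `b` first-generation vertices have `c 0, …, c (b-1)`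
children respectively (encoded by its set of depth-2 vertices). -/
def heightTwoTree (b : ℕ) (c : Fin b → ℕ) : Finset (List ℕ) :=
  Finset.univ.biUnion fun i : Fin b =>
    (Finset.range (c i)).image fun j => [(i : ℕ), j]

/-- Restricting i.i.d. labels along an injection of index types gives i.i.d. labels. -/
lemma map_comp_pi_of_injective {ι κ : Type*} [Fintype ι] [Fintype κ] (μ : Measure ℝ)
    [IsProbabilityMeasure μ] {e : κ → ι} (he : Function.Injective e) :
    (Measure.pi fun _ : ι => μ).map (fun ω k => ω (e k)) = Measure.pi fun _ : κ => μ := by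
  have h : iIndepFun (fun (i : ι) (ω : ι → ℝ) => ω i) (Measure.pi fun _ : ι => μ) :=
    iIndepFun_pi (X := fun _ x => x) fun _ => aemeasurable_id
  rw [(h.precomp he).map_fun_eq_pi_map fun k => (measurable_pi_apply (e k)).aemeasurable]
  congr 1
  ext1 k
  exact (measurePreserving_eval (fun _ : ι => μ) (e k)).map_eq

lemma map_piCurry_pi {ι : Type*} {κ : ι → Type*} [Fintype ι] [∀ i, Fintype (κ i)]
    (μ : Measure ℝ) [IsProbabilityMeasure μ] :
    (Measure.pi fun _ : (i : ι) × κ i => μ).map (MeasurableEquiv.piCurry fun _ _ => ℝ) =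
      Measure.pi fun i : ι => Measure.pi fun _ : κ i => μ := by
  have h := Measure.infinitePi_map_piCurry (X := fun (i : ι) (_ : κ i) => ℝ) fun _ _ => μ
  simpa only [Measure.infinitePi_eq_pi] using h

/-- The `k`-th moment of the conditional probability that a path has its labels in `D`, given the
label of its first vertex. -/
noncomputable def sectionMoment (μ : Measure ℝ) (D : Set (Fin 2 → ℝ)) (k : ℕ) : ℝ :=
  ∫ x, μ.real {y | ![x, y] ∈ D} ^ k ∂μ

lemma sectionMoment_nonneg (μ : Measure ℝ) (D : Set (Fin 2 → ℝ)) (k : ℕ) :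
    0 ≤ sectionMoment μ D k :=
  integral_nonneg fun _ => by positivity

section Labels

variable {μ : Measure ℝ} [IsProbabilityMeasure μ]

lemma measurable_measureReal_section {D : Set (Fin 2 → ℝ)} (hD : MeasurableSet D) :
    Measurable fun x => μ.real {y | ![x, y] ∈ D} := by
  have h : MeasurableSet {p : ℝ × ℝ | ![p.1, p.2] ∈ D} :=
    hD.preimage (measurable_pi_iff.2 fun i => by fin_cases i <;> simp <;> fun_prop)
  exact (measurable_measure_prodMk_left h).ennreal_toReal

lemma integrable_section_pow {D : Set (Fin 2 → ℝ)} (hD : MeasurableSet D) (k : ℕ) :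
    Integrable (fun x => μ.real {y | ![x, y] ∈ D} ^ k) μ := by
  refine Integrable.of_bound
    ((measurable_measureReal_section hD).pow_const k).aestronglyMeasurable 1 ?_
  refine ae_of_all _ fun x => ?_
  rw [Real.norm_of_nonneg (by positivity)]
  exact pow_le_one₀ measureReal_nonneg measureReal_le_one

/-- The probability that every path through a first-generation vertex with `n` children has labels
in `D`. -/
lemma pi_real_star (n : ℕ) {D : Set (Fin 2 → ℝ)} (hD : MeasurableSet D) :
    (Measure.pi fun _ : Fin (n + 1) => μ).real {η | ∀ j : Fin n, ![η 0, η j.succ] ∈ D} =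
      sectionMoment μ D n := by
  have hE : MeasurableSet {p : ℝ × (Fin n → ℝ) | ∀ j, ![p.1, p.2 j] ∈ D} := by
    rw [Set.ofPred_forall]
    refine MeasurableSet.iInter fun j =>
      hD.preimage (measurable_pi_iff.2 fun i => by fin_cases i <;> simp <;> fun_prop)
  have h := (measurePreserving_piFinSuccAbove (fun _ : Fin (n + 1) => μ) 0).measureReal_preimage
    hE.nullMeasurableSet
  have hsec (x : ℝ) : (Measure.pi fun _ : Fin n => μ).real
      (Prod.mk x ⁻¹' {p : ℝ × (Fin n → ℝ) | ∀ j, ![p.1, p.2 j] ∈ D}) =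
        μ.real {y | ![x, y] ∈ D} ^ n := by
    have : Prod.mk x ⁻¹' {p : ℝ × (Fin n → ℝ) | ∀ j, ![p.1, p.2 j] ∈ D} =
        Set.univ.pi fun _ => {y | ![x, y] ∈ D} := by ext; simp
    rw [this, measureReal_def, Measure.pi_pi]
    simp [measureReal_def]
  calc _ = (μ.prod (Measure.pi fun _ : Fin n => μ)).real
        {p : ℝ × (Fin n → ℝ) | ∀ j, ![p.1, p.2 j] ∈ D} := h
    _ = _ := by
      simp_rw [sectionMoment, ← hsec, measureReal_def]
      rw [integral_toReal (measurable_measure_prodMk_left hE).aemeasurable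
        (ae_of_all _ fun _ => measure_lt_top _ _), Measure.prod_apply hE]

lemma mem_heightTwoTree {b : ℕ} {c : Fin b → ℕ} {a : List ℕ} :
    a ∈ heightTwoTree b c ↔ ∃ (i : Fin b) (j : Fin (c i)), [(i : ℕ), (j : ℕ)] = a := by
  simp [heightTwoTree, Fin.exists_iff]

/-- The address of the vertex indexed by `⟨i, j⟩`: the `i`-th first-generation vertex if `j = 0`,
and its `(j - 1)`-st child otherwise. -/
def sigmaAddress {b : ℕ} (c : Fin b → ℕ) (v : (i : Fin b) × Fin (c i + 1)) : List ℕ :=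
  Fin.cases [(v.1 : ℕ)] (fun j => [(v.1 : ℕ), (j : ℕ)]) v.2

lemma sigmaAddress_injective {b : ℕ} (c : Fin b → ℕ) : Function.Injective (sigmaAddress c) := by
  rintro ⟨i, j⟩ ⟨i', j'⟩ h
  induction j using Fin.cases <;> induction j' using Fin.cases <;>
    simp [sigmaAddress, ← Fin.ext_iff] at h
  · subst h; rfl
  · obtain ⟨rfl, h⟩ := h
    rw [← Fin.ext_iff] at h
    rw [h]

lemma exists_sigmaAddress_eq {b : ℕ} {c : Fin b → ℕ} (v : verts 2 (heightTwoTree b c)) :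
    ∃ w, sigmaAddress c w = v := by
  obtain ⟨v, hv⟩ := v
  simp only [verts, Finset.mem_biUnion, mem_heightTwoTree, Finset.mem_image,
    Finset.mem_range] at hv
  obtain ⟨_, ⟨i, j, rfl⟩, k, hk, rfl⟩ := hv
  interval_cases k
  · exact ⟨⟨i, 0⟩, rfl⟩
  · exact ⟨⟨i, j.succ⟩, rfl⟩

lemma measurableSet_allPath (n : ℕ) (A : Finset (List ℕ)) {D : Set (Fin n → ℝ)}
    (hD : MeasurableSet D) :
    MeasurableSet {ω : verts n A → ℝ | ∀ a, ∀ ha : a ∈ A,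
      (fun i : Fin n => ω ⟨a.take (i.val + 1), take_mem_verts ha i.isLt⟩) ∈ D} := by
  simp_rw [Set.ofPred_forall]
  exact MeasurableSet.iInter fun a => MeasurableSet.iInter fun ha =>
    hD.preimage (measurable_pi_iff.2 fun i => measurable_pi_apply _)

lemma pathProb_eq_one_sub (n : ℕ) (A : Finset (List ℕ)) {B : Set (Fin n → ℝ)}
    (hB : MeasurableSet B) : pathProb μ n A B = 1 - allPathProb μ n A Bᶜ := by
  have h := probReal_compl_eq_one_sub (μ := Measure.pi fun _ : ↥(verts n A) => μ)
    (measurableSet_allPath n A hB.compl)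
  simp only [allPathProb, pathProb, ← measureReal_def]
  rw [← h]
  congr 1
  ext ω
  simp

lemma allPathProb_heightTwoTree {b : ℕ} (c : Fin b → ℕ) {D : Set (Fin 2 → ℝ)}
    (hD : MeasurableSet D) :
    allPathProb μ 2 (heightTwoTree b c) D = ∏ i, sectionMoment μ D (c i) := by
  choose e he using exists_sigmaAddress_eq (c := c)
  have he_inj : Function.Injective e := fun v w h => Subtype.ext (by rw [← he, ← he, h])
  have he_apply (w) (hw : sigmaAddress c w ∈ verts 2 (heightTwoTree b c)) :
      e ⟨sigmaAddress c w, hw⟩ = w := sigmaAddress_injective c (he _)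
  have hS := measurableSet_allPath 2 (heightTwoTree b c) hD
  set S := {ω : verts 2 (heightTwoTree b c) → ℝ | ∀ a, ∀ ha : a ∈ heightTwoTree b c,
      (fun i : Fin 2 => ω ⟨a.take (i.val + 1), take_mem_verts ha i.isLt⟩) ∈ D} with hS_def
  let T : (i : Fin b) → Set (Fin (c i + 1) → ℝ) :=
    fun i => {η | ∀ j : Fin (c i), ![η 0, η j.succ] ∈ D}
  have hpre : (fun (ω : (i : Fin b) × Fin (c i + 1) → ℝ) k => ω (e k)) ⁻¹' S =
      MeasurableEquiv.piCurry (fun _ _ => ℝ) ⁻¹' Set.univ.pi T := by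
    ext ω
    have key (i : Fin b) (j : Fin (c i)) (ha : [(i : ℕ), (j : ℕ)] ∈ heightTwoTree b c) :
        (fun l : Fin 2 => ω (e ⟨[(i : ℕ), (j : ℕ)].take (l.val + 1),
          take_mem_verts ha l.isLt⟩)) = ![ω ⟨i, 0⟩, ω ⟨i, j.succ⟩] := by
      ext l
      fin_cases l
      · exact congrArg ω (he_apply ⟨i, 0⟩ _)
      · exact congrArg ω (he_apply ⟨i, j.succ⟩ _)
    simp only [hS_def, Set.mem_preimage, Set.mem_ofPred_eq, Set.mem_pi, Set.mem_univ, true_imp_iff,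
      T, MeasurableEquiv.coe_piCurry, Sigma.curry]
    constructor
    · intro h i j
      have ha : [(i : ℕ), (j : ℕ)] ∈ heightTwoTree b c := mem_heightTwoTree.2 ⟨i, j, rfl⟩
      exact key i j ha ▸ h _ ha
    · intro h a ha
      obtain ⟨i, j, rfl⟩ := mem_heightTwoTree.1 ha
      rw [key i j ha]
      exact h i j
  have hmeas : Measurable fun (ω : (i : Fin b) × Fin (c i + 1) → ℝ) k => ω (e k) :=
    measurable_pi_iff.2 fun k => measurable_pi_apply _
  rw [allPathProb, ← hS_def, ← map_comp_pi_of_injective μ he_inj, Measure.map_apply hmeas hS, hpre,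
    ← MeasurableEquiv.map_apply, map_piCurry_pi, Measure.pi_pi, ENNReal.toReal_prod]
  exact Finset.prod_congr rfl fun i _ => pi_real_star (c i) hD

lemma sectionMoment_zero (D : Set (Fin 2 → ℝ)) : sectionMoment μ D 0 = 1 := by
  simp [sectionMoment]

lemma antitone_sectionMoment {D : Set (Fin 2 → ℝ)} (hD : MeasurableSet D) :
    Antitone (sectionMoment μ D) := fun _ _ hkl =>
  integral_mono (integrable_section_pow hD _) (integrable_section_pow hD _) fun _ =>
    pow_le_pow_of_le_one measureReal_nonneg measureReal_le_one hkl

lemma sectionMoment_succ_sq_le {D : Set (Fin 2 → ℝ)} (hD : MeasurableSet D) (k : ℕ) :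
    sectionMoment μ D (k + 1) ^ 2 ≤ sectionMoment μ D k * sectionMoment μ D (k + 2) := by
  have h : discrim (sectionMoment μ D k) (-2 * sectionMoment μ D (k + 1))
      (sectionMoment μ D (k + 2)) ≤ 0 := by
    refine discrim_le_zero fun t => ?_
    have h0 := (integrable_section_pow (μ := μ) hD k).mul_const (t * t)
    have h1 := (integrable_section_pow (μ := μ) hD (k + 1)).const_mul (-2)|>.mul_const t
    have h2 := integrable_section_pow (μ := μ) hD (k + 2)
    simp only [sectionMoment]
    have h01 := h0.add h1
    simp only [Pi.add_def] at h01
    rw [← integral_mul_const, ← integral_const_mul, ← integral_mul_const, ← integral_add h0 h1,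
      ← integral_add h01 h2]
    refine integral_nonneg fun x => ?_
    have hx : 0 ≤ μ.real {y | ![x, y] ∈ D} ^ k * (μ.real {y | ![x, y] ∈ D} - t) ^ 2 := by
      positivity
    simp only [Pi.zero_apply]
    linear_combination hx
  rw [discrim] at h
  linarith

end Labels

/-- Abel summation: a monotone weight bounded below by `a ≥ 0` against a sequence with nonnegative
tail sums. -/
lemma mul_sum_le_sum_mul_of_tails_nonneg {b : ℕ} {w d : Fin b → ℝ} {a : ℝ} (hw : Monotone w)
    (haw : ∀ i, a ≤ w i)
    (hd : ∀ k : ℕ, 0 ≤ ∑ i ∈ Finset.univ.filter (fun i : Fin b => k ≤ i.val), d i) :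
    a * ∑ i, d i ≤ ∑ i, w i * d i := by
  induction b generalizing a with
  | zero => simp
  | succ b ih =>
    have hsum : 0 ≤ ∑ i, d i := by simpa using hd 0
    have h := ih (w := fun i => w i.succ) (d := fun i => d i.succ) (a := w 0)
      (fun i j hij => hw (Fin.succ_le_succ_iff.2 hij)) (fun i => hw (Fin.zero_le _)) fun k => by
        have := hd (k + 1)
        rw [Finset.sum_filter, Fin.sum_univ_succ] at this
        simpa [Finset.sum_filter] using this
    calc a * ∑ i, d i ≤ w 0 * ∑ i, d i := mul_le_mul_of_nonneg_right (haw 0) hsum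
      _ ≤ _ := by
        rw [Fin.sum_univ_succ, Fin.sum_univ_succ, mul_add]
        gcongr

/-- A discretely convex function lies above its discrete tangents. -/
lemma tangent_le_of_monotone_diff {f : ℕ → ℝ} (hf : Monotone fun n => f (n + 1) - f n) (m n : ℕ) :
    (f (m + 1) - f m) * ((n : ℝ) - m) ≤ f n - f m := by
  rcases le_total m n with h | h
  · induction n, h using Nat.le_induction with
    | base => simp
    | succ n hmn ih =>
      have := hf hmn
      push_cast
      simp only at this
      linarith
  · induction h using Nat.decreasingInduction with
    | self => simp
    | of_succ n hn ih =>
      have := hf hn.le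
      push_cast at ih
      simp only at this
      linarith

/-- Weak supermajorization for antitone discretely convex functions. -/
lemma sum_le_sum_of_tails_le {b : ℕ} {c c' : Fin b → ℕ} (hc : Antitone c) {f : ℕ → ℝ}
    (hanti : Antitone f) (hconv : Monotone fun n => f (n + 1) - f n)
    (h : ∀ k : ℕ, ∑ i ∈ Finset.univ.filter (fun i : Fin b => k ≤ i.val), c' i ≤
      ∑ i ∈ Finset.univ.filter (fun i : Fin b => k ≤ i.val), c i) :
    ∑ i, f (c i) ≤ ∑ i, f (c' i) := by
  have habel := mul_sum_le_sum_mul_of_tails_nonneg (a := 0)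
    (w := fun i => -(f (c i + 1) - f (c i))) (d := fun i => (c i : ℝ) - c' i)
    (fun i j hij => neg_le_neg (hconv (hc hij)))
    (fun i => by linarith [hanti (Nat.le_succ (c i))]) fun k => by
      rw [Finset.sum_sub_distrib, sub_nonneg]
      exact_mod_cast h k
  have htan := Finset.sum_le_sum fun i (_ : i ∈ Finset.univ) =>
    tangent_le_of_monotone_diff hconv (c i) (c' i)
  rw [Finset.sum_sub_distrib] at htan
  have heq : ∑ i, -(f (c i + 1) - f (c i)) * ((c i : ℝ) - c' i) =
      ∑ i, (f (c i + 1) - f (c i)) * ((c' i : ℝ) - c i) :=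
    Finset.sum_congr rfl fun i _ => by ring
  linarith

/-- Weak supermajorization for products of antitone log-convex sequences. -/
lemma prod_le_prod_of_tails_le {b : ℕ} {c c' : Fin b → ℕ} (hc : Antitone c) {M : ℕ → ℝ}
    (h0 : M 0 = 1) (hnonneg : ∀ k, 0 ≤ M k) (hanti : Antitone M)
    (hconv : ∀ k, M (k + 1) ^ 2 ≤ M k * M (k + 2))
    (h : ∀ k : ℕ, ∑ i ∈ Finset.univ.filter (fun i : Fin b => k ≤ i.val), c' i ≤
      ∑ i ∈ Finset.univ.filter (fun i : Fin b => k ≤ i.val), c i) :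
    ∏ i, M (c i) ≤ ∏ i, M (c' i) := by
  rcases (hnonneg 1).eq_or_lt with h1 | h1
  · by_cases hzero : ∀ i, c i = 0
    · have hzero' : ∀ i, c' i = 0 := by
        have := h 0
        simpa [hzero] using this
      simp [hzero, hzero']
    · push Not at hzero
      obtain ⟨i, hi⟩ := hzero
      have hMi : M (c i) = 0 :=
        le_antisymm (h1 ▸ hanti (Nat.one_le_iff_ne_zero.2 hi)) (hnonneg _)
      rw [Finset.prod_eq_zero (Finset.mem_univ i) hMi]
      exact Finset.prod_nonneg fun _ _ => hnonneg _
  · have hpos (k : ℕ) : 0 < M k := by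
      suffices 0 < M k ∧ 0 < M (k + 1) from this.1
      induction k with
      | zero => exact ⟨h0 ▸ one_pos, h1⟩
      | succ k ih =>
        exact ⟨ih.2, pos_of_mul_pos_right ((pow_pos ih.2 2).trans_le (hconv k)) ih.1.le⟩
    have hlog := sum_le_sum_of_tails_le (f := fun k => Real.log (M k)) hc
      (fun k l hkl => Real.log_le_log (hpos l) (hanti hkl))
      (monotone_nat_of_le_succ fun k => by
        have := Real.log_le_log (pow_pos (hpos _) 2) (hconv k)
        rw [Real.log_pow, Real.log_mul (hpos _).ne' (hpos _).ne'] at this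
        push_cast at this
        linarith) h
    rw [← Real.log_prod fun i _ => (hpos _).ne', ← Real.log_prod fun i _ => (hpos _).ne'] at hlog
    exact (Real.log_le_log_iff (Finset.prod_pos fun i _ => hpos _)
      (Finset.prod_pos fun i _ => hpos _)).1 hlog

/-- Tail sums of antitone sequences compare as soon as all sums of truncations do. -/
lemma tails_le_of_sum_min_le {b : ℕ} {c c' : Fin b → ℕ} (hc' : Antitone c')
    (h : ∀ m, ∑ i, min m (c' i) ≤ ∑ i, min m (c i)) (k : ℕ) :
    ∑ i ∈ Finset.univ.filter (fun i : Fin b => k ≤ i.val), c' i ≤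
      ∑ i ∈ Finset.univ.filter (fun i : Fin b => k ≤ i.val), c i := by
  rcases lt_or_ge k b with hk | hk
  · set m := c' ⟨k, hk⟩
    have hm := h m
    rw [← Finset.sum_filter_add_sum_filter_not _ (fun i : Fin b => k ≤ i.val),
      ← Finset.sum_filter_add_sum_filter_not _ (fun i : Fin b => k ≤ i.val)
        (fun i => min m (c i))] at hm
    have h1 : ∑ i ∈ Finset.univ.filter (fun i : Fin b => k ≤ i.val), min m (c' i) =
        ∑ i ∈ Finset.univ.filter (fun i : Fin b => k ≤ i.val), c' i :=
      Finset.sum_congr rfl fun i hi =>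
        min_eq_right (hc' (Fin.mk_le_of_le_val (Finset.mem_filter.1 hi).2))
    have h2 : ∑ i ∈ Finset.univ.filter (fun i : Fin b => k ≤ i.val), min m (c i) ≤
        ∑ i ∈ Finset.univ.filter (fun i : Fin b => k ≤ i.val), c i :=
      Finset.sum_le_sum fun i _ => min_le_right _ _
    have h3 : ∑ i ∈ Finset.univ.filter (fun i : Fin b => ¬ k ≤ i.val), min m (c i) ≤
        ∑ i ∈ Finset.univ.filter (fun i : Fin b => ¬ k ≤ i.val), min m (c' i) :=
      Finset.sum_le_sum fun i hi => le_min (min_le_left _ _) ((min_le_left _ _).trans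
        (hc' (Fin.le_def.2 (not_le.1 (Finset.mem_filter.1 hi).2).le)))
    omega
  · rw [Finset.filter_false_of_mem fun i _ => not_le.2 (i.isLt.trans_le hk)]
    simp

/-- The uniform distribution on the unit interval. -/
noncomputable def uniformUnit : Measure ℝ := volume.restrict (Set.Ioc 0 1)

instance : IsProbabilityMeasure uniformUnit := ⟨by simp [uniformUnit]⟩

lemma uniformUnit_real_Iic {p : ℝ} (hp0 : 0 ≤ p) (hp1 : p ≤ 1) :
    uniformUnit.real (Set.Iic p) = p := by
  have : Set.Iic p ∩ Set.Ioc 0 1 = Set.Ioc 0 p := by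
    ext x
    simp only [Set.mem_inter_iff, Set.mem_Iic, Set.mem_Ioc]
    exact ⟨fun h => ⟨h.2.1, h.1⟩, fun h => ⟨h.2, h.1, h.2.trans hp1⟩⟩
  rw [measureReal_def, uniformUnit, Measure.restrict_apply measurableSet_Iic, this]
  simp [hp0]

/-- The label pairs whose first entry is at most `p` or whose second entry is at most `q`. -/
def eitherLE (p q : ℝ) : Set (Fin 2 → ℝ) := {v | v 0 ≤ p ∨ v 1 ≤ q}

lemma measurableSet_eitherLE (p q : ℝ) : MeasurableSet (eitherLE p q) :=
  (measurableSet_le (measurable_pi_apply 0) measurable_const).union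
    (measurableSet_le (measurable_pi_apply 1) measurable_const)

lemma sectionMoment_eitherLE {p q : ℝ} (hp0 : 0 ≤ p) (hp1 : p ≤ 1) (hq0 : 0 ≤ q) (hq1 : q ≤ 1)
    (k : ℕ) : sectionMoment uniformUnit (eitherLE p q) k = p + (1 - p) * q ^ k := by
  have h (x : ℝ) : uniformUnit.real {y | ![x, y] ∈ eitherLE p q} ^ k =
      q ^ k + (Set.Iic p).indicator (fun _ => 1 - q ^ k) x := by
    by_cases hx : x ≤ p
    · simp [eitherLE, hx]
    · have : {y | ![x, y] ∈ eitherLE p q} = Set.Iic q := by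
        ext y; simp [eitherLE, hx]
      rw [this, uniformUnit_real_Iic hq0 hq1]
      simp [hx]
  simp_rw [sectionMoment, h]
  rw [integral_add (integrable_const _)
    ((integrable_const _).indicator measurableSet_Iic),
    integral_indicator_const _ measurableSet_Iic, uniformUnit_real_Iic hp0 hp1]
  simp
  ring

lemma pow_min_le_add_mul {q : ℝ} (hq0 : 0 ≤ q) (hq1 : q ≤ 1) (m n : ℕ) :
    q ^ min m n ≤ q ^ m + (1 - q ^ m) * q ^ n := by
  have hm0 := pow_nonneg hq0 m
  have hm1 := pow_le_one₀ hq0 hq1 (n := m)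
  have hn0 := pow_nonneg hq0 n
  have hn1 := pow_le_one₀ hq0 hq1 (n := n)
  rcases min_choice m n with h | h <;> rw [h] <;> nlinarith

lemma add_mul_le_two_mul_pow_min {q : ℝ} (hq0 : 0 ≤ q) (hq1 : q ≤ 1) (m n : ℕ) :
    q ^ m + (1 - q ^ m) * q ^ n ≤ 2 * q ^ min m n := by
  have hm : q ^ m ≤ q ^ min m n := pow_le_pow_of_le_one hq0 hq1 (min_le_left _ _)
  have hn : q ^ n ≤ q ^ min m n := pow_le_pow_of_le_one hq0 hq1 (min_le_right _ _)
  nlinarith [mul_nonneg (pow_nonneg hq0 m) (pow_nonneg hq0 n)]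

/-- Comparison of the two-valued conditional probabilities `1` and `q`, as `q → 0`, gives the
comparison of sums of truncations. -/
lemma sum_min_le_of_prod_le {b : ℕ} {c c' : Fin b → ℕ} (m : ℕ)
    (h : ∀ q : ℝ, 0 < q → q ≤ 1 → ∏ i, (q ^ m + (1 - q ^ m) * q ^ c i) ≤
      ∏ i, (q ^ m + (1 - q ^ m) * q ^ c' i)) :
    ∑ i, min m (c' i) ≤ ∑ i, min m (c i) := by
  by_contra! hlt
  set q : ℝ := (1 / 2) ^ (b + 1) with hq
  have hq0 : 0 < q := by positivity
  have hq1 : q ≤ 1 := pow_le_one₀ (by norm_num) (by norm_num)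
  have hlow : q ^ ∑ i, min m (c i) ≤ ∏ i, (q ^ m + (1 - q ^ m) * q ^ c i) := by
    rw [← Finset.prod_pow_eq_pow_sum]
    exact Finset.prod_le_prod (fun i _ => by positivity) fun i _ =>
      pow_min_le_add_mul hq0.le hq1 m (c i)
  have hup : ∏ i, (q ^ m + (1 - q ^ m) * q ^ c' i) ≤ 2 ^ b * q ^ ∑ i, min m (c' i) := by
    calc _ ≤ ∏ i, 2 * q ^ min m (c' i) := Finset.prod_le_prod
          (fun i _ => (by positivity : (0 : ℝ) ≤ q ^ min m (c' i)).trans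
            (pow_min_le_add_mul hq0.le hq1 m (c' i)))
          fun i _ => add_mul_le_two_mul_pow_min hq0.le hq1 m (c' i)
      _ = _ := by simp [Finset.prod_mul_distrib, Finset.prod_pow_eq_pow_sum]
  have hpow : q ^ ∑ i, min m (c' i) ≤ q ^ (∑ i, min m (c i) + 1) :=
    pow_le_pow_of_le_one hq0.le hq1 hlt
  have hhalf : 2 ^ b * q = 1 / 2 := by
    rw [hq, pow_succ, ← mul_assoc, ← mul_pow]
    norm_num
  have hpos : 0 < q ^ ∑ i, min m (c i) := by positivity
  have : q ^ ∑ i, min m (c i) ≤ 1 / 2 * q ^ ∑ i, min m (c i) :=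
    calc _ ≤ 2 ^ b * q ^ ∑ i, min m (c' i) := hlow.trans ((h q hq0 hq1).trans hup)
      _ ≤ 2 ^ b * q ^ (∑ i, min m (c i) + 1) := by gcongr
      _ = _ := by rw [pow_succ, ← hhalf]; ring
  linarith

/-- a height-2 tree with (decreasingly ordered, zero-padded) children
counts `c` dominates one with counts `c'` iff all the tail sums of `c` dominate
those of `c'`. -/
theorem height_two_domination_iff (b : ℕ) (c c' : Fin b → ℕ)
    (hc : Antitone c) (hc' : Antitone c') :
    (∀ (μ : Measure ℝ), IsProbabilityMeasure μ → ∀ B : Set (Fin 2 → ℝ), MeasurableSet B →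
        pathProb μ 2 (heightTwoTree b c') B ≤ pathProb μ 2 (heightTwoTree b c) B) ↔
      ∀ k : ℕ, ∑ i ∈ Finset.univ.filter (fun i : Fin b => k ≤ i.val), c' i ≤
        ∑ i ∈ Finset.univ.filter (fun i : Fin b => k ≤ i.val), c i := by
  constructor
  · refine fun h => tails_le_of_sum_min_le hc' fun m => sum_min_le_of_prod_le m fun q hq0 hq1 => ?_
    have hD := measurableSet_eitherLE (q ^ m) q
    have hB := h uniformUnit inferInstance _ hD.compl
    rw [pathProb_eq_one_sub _ _ hD.compl, pathProb_eq_one_sub _ _ hD.compl, compl_compl,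
      allPathProb_heightTwoTree _ hD, allPathProb_heightTwoTree _ hD] at hB
    simp_rw [sectionMoment_eitherLE (pow_nonneg hq0.le m) (pow_le_one₀ hq0.le hq1) hq0.le hq1]
      at hB
    linarith
  · intro h μ _ B hB
    rw [pathProb_eq_one_sub _ _ hB, pathProb_eq_one_sub _ _ hB,
      allPathProb_heightTwoTree _ hB.compl, allPathProb_heightTwoTree _ hB.compl]
    exact sub_le_sub_left (prod_le_prod_of_tails_le hc (sectionMoment_zero _)
      (sectionMoment_nonneg μ _) (antitone_sectionMoment hB.compl)
      (sectionMoment_succ_sq_le hB.compl) h) 1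
end
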